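/- Let D be a database and Σ a finite set of TGDs that is D-weakly-acyclic. Then maxdepth(D,Σ) ≤ d_SL(Σ), where d_SL(Σ) = |sch(Σ)|·ar(Σ). -/

import Mathlib

set_option maxHeartbeats 1000000

/-! ### Basic syntax: atoms, TGDs, terms -/

/-- An atom: a predicate name together with a list of arguments. -/
structure Atom (T : Type) where
  pred : ℕ
  args : List T
deriving DecidableEq

def Atom.map {T U : Type} (f : T → U) (a : Atom T) : Atom U :=
  ⟨a.pred, a.args.map f⟩

/-- The signature (predicate name, arity) of an atom. -/
def Atom.sig {T : Type} (a : Atom T) : ℕ × ℕ := (a.pred, a.args.length)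

def Atom.equivProd : Atom ℕ ≃ ℕ × List ℕ where
  toFun a := (a.pred, a.args)
  invFun p := ⟨p.1, p.2⟩
  left_inv a := rfl
  right_inv p := rfl

instance : Encodable (Atom ℕ) := Encodable.ofEquiv _ Atom.equivProd

/-- A tuple-generating dependency, given by its (non-empty) body and head,
whose atoms carry variables (natural numbers) as arguments. -/
structure TGD where
  body : List (Atom ℕ)
  head : List (Atom ℕ)
  body_ne : body ≠ []
  head_ne : head ≠ []

def atomVars (a : Atom ℕ) : Finset ℕ := a.args.toFinset

def TGD.bodyVars (σ : TGD) : Finset ℕ := σ.body.foldr (fun a s => atomVars a ∪ s) ∅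
def TGD.headVars (σ : TGD) : Finset ℕ := σ.head.foldr (fun a s => atomVars a ∪ s) ∅
/-- The frontier of a TGD: variables occurring both in the body and in the head. -/
def TGD.frontier (σ : TGD) : Finset ℕ := σ.bodyVars ∩ σ.headVars
/-- The existentially quantified variables: head variables not occurring in the body. -/
def TGD.exVars (σ : TGD) : Finset ℕ := σ.headVars \ σ.bodyVars

/-- Terms: constants, and labelled nulls `⊥^z_{σ,h}` determined by a TGD `σ`,
a substitution `h` (the restriction of the trigger homomorphism to the frontier)
and a variable `z`. -/
inductive TermT : Type where
  | const : ℕ → TermT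
  | null : TGD → (ℕ → TermT) → ℕ → TermT

/-- The depth of a term. -/
def TermT.depth : TermT → ℕ
  | .const _ => 0
  | .null σ h _ => 1 + σ.frontier.sup (fun x => (h x).depth)

/-- The depth of an atom: the maximal depth of its arguments. -/
def Atom.depth (a : Atom TermT) : ℕ := (a.args.map TermT.depth).foldr max 0

/-! ### The semi-oblivious chase -/

/-- Restriction of a substitution to the frontier of a TGD (with default value elsewhere). -/
def TGD.restrict (σ : TGD) (h : ℕ → TermT) : ℕ → TermT :=
  fun x => if x ∈ σ.frontier then h x else .const 0

/-- The map `μ` sending each frontier variable `x` to `h x` and each other (existential)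
variable `z` to the null `⊥^z_{σ,h|fr(σ)}`. -/
def TGD.mu (σ : TGD) (h : ℕ → TermT) : ℕ → TermT :=
  fun x => if x ∈ σ.frontier then h x else .null σ (σ.restrict h) x

/-- The result of the trigger `(σ,h)`. -/
def TGD.result (σ : TGD) (h : ℕ → TermT) : Set (Atom TermT) :=
  {a | ∃ b ∈ σ.head, a = b.map (σ.mu h)}

abbrev Database := Finset (Atom ℕ)
abbrev Instance := Set (Atom TermT)

def dbInstance (D : Database) : Instance := (Atom.map TermT.const) '' ↑D

/-- `chase D S` (the result of any valid semi-oblivious chase derivation of `D` w.r.t. `S`),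
defined as the least set of atoms containing `D` and closed under all triggers. -/
inductive InChase (D : Database) (S : Set TGD) : Atom TermT → Prop
  | db {a : Atom ℕ} : a ∈ D → InChase D S (a.map TermT.const)
  | step {σ : TGD} (hσ : σ ∈ S) (h : ℕ → TermT)
      (hb : ∀ b ∈ σ.body, InChase D S (b.map h))
      {a : Atom TermT} (ha : a ∈ σ.result h) : InChase D S a

def chase (D : Database) (S : Set TGD) : Instance := {a | InChase D S a}

/-- The active domain of an instance: the set of terms occurring in it. -/
def adom (I : Instance) : Set TermT := {t | ∃ a ∈ I, t ∈ a.args}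

/-- `Σ ∈ CT_D`: the chase of `D` w.r.t. `Σ` is finite. -/
def InCT (D : Database) (S : Set TGD) : Prop := (chase D S).Finite

open Classical in
/-- The maximal depth of a term occurring in `chase D S`, and `⊤` if the chase is infinite. -/
noncomputable def maxdepth (D : Database) (S : Set TGD) : ℕ∞ :=
  if (chase D S).Finite then ⨆ t ∈ adom (chase D S), (TermT.depth t : ℕ∞) else ⊤

/-! ### Schema, arity, classes of TGDs -/

def TGD.atomsList (σ : TGD) : List (Atom ℕ) := σ.body ++ σ.head

/-- The schema of a set of TGDs: the (predicate name, arity) pairs occurring in it. -/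
def sch (S : Set TGD) : Set (ℕ × ℕ) := {p | ∃ σ ∈ S, ∃ a ∈ σ.atomsList, a.sig = p}

/-- The maximal arity of a predicate of the schema. -/
noncomputable def arity (S : Set TGD) : ℕ := sSup ((fun p => p.2) '' sch S)

/-- The set of atoms occurring in the TGDs of `S`. -/
def atomsOf (S : Set TGD) : Set (Atom ℕ) := {a | ∃ σ ∈ S, a ∈ σ.atomsList}

/-- `‖Σ‖ = |atoms(Σ)| · |sch(Σ)| · ar(Σ)`. -/
noncomputable def tgdNorm (S : Set TGD) : ℕ := (atomsOf S).ncard * (sch S).ncard * arity S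

/-- A TGD is guarded if some body atom contains all body variables. -/
def TGD.Guarded (σ : TGD) : Prop := ∃ a ∈ σ.body, σ.bodyVars ⊆ atomVars a

/-- A TGD is linear if its body consists of a single atom. -/
def TGD.Linear (σ : TGD) : Prop := ∃ a, σ.body = [a]

/-- A TGD is simple linear if its body is a single atom without repeated variables. -/
def TGD.SimpleLinear (σ : TGD) : Prop := ∃ a, σ.body = [a] ∧ a.args.Nodup

/-- The guard of a TGD: the leftmost body atom containing all body variables. -/
def TGD.guard (σ : TGD) : Atom ℕ :=
  (σ.body.find? (fun a => decide (σ.bodyVars ⊆ atomVars a))).getD ⟨0, []⟩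

/-! ### Chase derivations and the guarded chase forest -/

def IsTrigger (S : Set TGD) (σ : TGD) (h : ℕ → TermT) (I : Instance) : Prop :=
  σ ∈ S ∧ ∀ b ∈ σ.body, b.map h ∈ I

def IsActive (S : Set TGD) (σ : TGD) (h : ℕ → TermT) (I : Instance) : Prop :=
  IsTrigger S σ h I ∧ ¬ σ.result h ⊆ I

/-- A chase derivation of `D` w.r.t. `S`: at each step either an active trigger is applied,
or no active trigger exists and the instance stays put (the derivation has terminated). -/
structure ChaseDerivation (D : Database) (S : Set TGD) where
  inst : ℕ → Instance
  trig : ℕ → Option (TGD × (ℕ → TermT))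
  init : inst 0 = dbInstance D
  step_some : ∀ i σ h, trig i = some (σ, h) →
    IsActive S σ h (inst i) ∧ inst (i + 1) = inst i ∪ σ.result h
  step_none : ∀ i, trig i = none →
    (∀ σ h, ¬ IsActive S σ h (inst i)) ∧ inst (i + 1) = inst i

/-- The derivation is finite: it eventually reaches an instance with no active trigger. -/
def ChaseDerivation.IsFiniteDer {D : Database} {S : Set TGD} (δ : ChaseDerivation D S) : Prop :=
  ∃ i, δ.trig i = none

/-- Fairness: every active trigger eventually becomes non-active. -/
def ChaseDerivation.Fair {D : Database} {S : Set TGD} (δ : ChaseDerivation D S) : Prop :=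
  ∀ i σ h, IsActive S σ h (δ.inst i) → ∃ j, i < j ∧ ¬ IsActive S σ h (δ.inst j)

def ChaseDerivation.Valid {D : Database} {S : Set TGD} (δ : ChaseDerivation D S) : Prop :=
  δ.IsFiniteDer ∨ δ.Fair

/-- The edge relation of the guarded chase forest of a derivation. -/
def gedge {D : Database} {S : Set TGD} (δ : ChaseDerivation D S) (α β : Atom TermT) : Prop :=
  ∃ i σ h, δ.trig i = some (σ, h) ∧ α = (TGD.guard σ).map h ∧
    β ∈ δ.inst (i + 1) \ δ.inst i

/-- The tree of the guarded chase forest rooted at the database atom `α`. -/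
def gtree {D : Database} {S : Set TGD} (δ : ChaseDerivation D S) (α : Atom ℕ) : Set (Atom TermT) :=
  {β | Relation.ReflTransGen (gedge δ) (α.map TermT.const) β}

/-- The atoms of depth `i` in the tree rooted at `α`. -/
def gtreeLevel {D : Database} {S : Set TGD} (δ : ChaseDerivation D S) (α : Atom ℕ) (i : ℕ) :
    Set (Atom TermT) :=
  {β ∈ gtree δ α | Atom.depth β = i}

/-! ### Dependency graph, reachability and non-uniform weak-acyclicity -/

/-- A position `(R, i)` of a schema: a (predicate name, arity) pair and an argument index. -/
abbrev Pos := (ℕ × ℕ) × ℕ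

def occursAt {T : Type} (x : T) (a : Atom T) (p : Pos) : Prop :=
  p.1 = a.sig ∧ a.args[p.2]? = some x

/-- Normal edges of the dependency graph. -/
def NormalEdge (S : Set TGD) (p q : Pos) : Prop :=
  ∃ σ ∈ S, ∃ x ∈ σ.frontier, (∃ a ∈ σ.body, occursAt x a p) ∧ (∃ b ∈ σ.head, occursAt x b q)

/-- Special edges of the dependency graph. -/
def SpecialEdge (S : Set TGD) (p q : Pos) : Prop :=
  ∃ σ ∈ S, ∃ x ∈ σ.frontier, (∃ a ∈ σ.body, occursAt x a p) ∧
    (∃ z ∈ σ.exVars, ∃ b ∈ σ.head, occursAt z b q)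

def predEdge (S : Set TGD) (R P : ℕ × ℕ) : Prop :=
  ∃ σ ∈ S, (∃ a ∈ σ.body, a.sig = R) ∧ (∃ b ∈ σ.head, b.sig = P)

/-- `R ⤳_Σ P`: predicate reachability. -/
def Reach (S : Set TGD) : (ℕ × ℕ) → (ℕ × ℕ) → Prop := Relation.ReflTransGen (predEdge S)

/-- `Σ` is `D`-weakly-acyclic: no `D`-supported cycle of the dependency graph
contains a special edge. -/
def DWeaklyAcyclic (D : Database) (S : Set TGD) : Prop :=
  ¬ ∃ (n : ℕ) (c : ℕ → Pos) (sp : ℕ → Bool),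
      c (n + 1) = c 0 ∧
      (∀ i ≤ n, if sp i then SpecialEdge S (c i) (c (i + 1))
                else NormalEdge S (c i) (c (i + 1))) ∧
      (∃ i ≤ n, sp i = true) ∧
      (∃ i ≤ n, ∃ a ∈ D, Reach S a.sig (c i).1)

noncomputable def dSL (S : Set TGD) : ℕ := (sch S).ncard * arity S
noncomputable def fSL (S : Set TGD) : ℕ := (dSL S + 1) * tgdNorm S ^ (2 * arity S * (dSL S + 1))
noncomputable def dL (S : Set TGD) : ℕ := (sch S).ncard * arity S ^ (arity S + 1)
noncomputable def fL (S : Set TGD) : ℕ := (dL S + 1) * tgdNorm S ^ (2 * arity S * (dL S + 1))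
noncomputable def dG (S : Set TGD) : ℕ :=
  (sch S).ncard * arity S ^ (2 * arity S + 1) * 2 ^ ((sch S).ncard * arity S ^ arity S)
noncomputable def fG (S : Set TGD) : ℕ := (dG S + 1) * tgdNorm S ^ (2 * arity S * (dG S + 1))

/-! ### Simplification -/

open Classical in
/-- `unique(t̄)`: keep only the first occurrence of each term. -/
noncomputable def uniqueList {α : Type} : List α → List α
  | [] => []
  | a :: l => a :: uniqueList (l.filter fun b => decide (b ≠ a))
termination_by l => l.length
decreasing_by
  simp only [List.length_cons, List.length_unattach]
  exact Nat.lt_succ_of_le ((List.length_filter_le _ _).trans (le_of_eq List.length_attach))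

open Classical in
/-- `id(t̄)`: for each component, the position of `unique(t̄)` at which it appears. -/
noncomputable def idTuple {α : Type} (l : List α) : List ℕ :=
  l.map (fun t => (uniqueList l).idxOf t)

/-- The simplification of an atom `R(t̄)`: the atom `R_{id(t̄)}(unique(t̄))`, where the
fresh predicate name `R_{id(t̄)}` is obtained by pairing `R` with an encoding of `id(t̄)`. -/
noncomputable def simpleAtom {α : Type} (a : Atom α) : Atom α :=
  ⟨Nat.pair a.pred (Encodable.encode (idTuple a.args)), uniqueList a.args⟩

/-- `simple(D)`. -/
noncomputable def simpleDB (D : Database) : Database := D.image simpleAtom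

/-- A specialization of the tuple of variables `xs`:
`f x₁ = x₁`, `f xᵢ ∈ {f x₁, …, f xᵢ₋₁, xᵢ}`, and `f` is the identity off `xs`. -/
def IsSpecialization (xs : List ℕ) (f : ℕ → ℕ) : Prop :=
  (∀ v, v ∉ xs → f v = v) ∧
  ∀ i : Fin xs.length, f (xs.get i) ∈ ((xs.take i).map f) ++ [xs.get i]

/-- The body atom of a (linear) TGD. -/
def TGD.bodyAtom (σ : TGD) : Atom ℕ := σ.body.head σ.body_ne

/-- The simplification of a linear TGD induced by a specialization `f`. -/
noncomputable def TGD.simplify (σ : TGD) (f : ℕ → ℕ) : TGD where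
  body := [simpleAtom (σ.bodyAtom.map f)]
  head := σ.head.map (fun b => simpleAtom (b.map f))
  body_ne := by simp
  head_ne := by
    intro hcon
    exact σ.head_ne (List.map_eq_nil_iff.mp hcon)

/-- `simple(Σ)`: all simplifications of TGDs of `Σ` induced by some specialization. -/
def simpleTGDs (S : Set TGD) : Set TGD :=
  {τ | ∃ σ ∈ S, ∃ f : ℕ → ℕ, IsSpecialization σ.bodyAtom.args f ∧ τ = σ.simplify f}

/-- Equivalence of terms up to simplification: the map
`g = {f x ↦ h x : x ∈ fr(σ)}` is a well-defined function on `fr(σ_f)` (witnessed by the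
section `sec` of `f`), and `g y ≡_sim h' y` for every `y ∈ fr(σ_f)`. -/
inductive EqSim : TermT → TermT → Prop
  | const (c : ℕ) : EqSim (.const c) (.const c)
  | null (σ : TGD) (f : ℕ → ℕ) (sec : ℕ → ℕ) (h h' : ℕ → TermT) (z : ℕ)
      (hf : IsSpecialization σ.bodyAtom.args f)
      (hfun : ∀ x ∈ σ.frontier, ∀ y ∈ σ.frontier, f x = f y → h x = h y)
      (hdom : ∀ x ∈ σ.frontier, f x ∈ (σ.simplify f).frontier)
      (hsec : ∀ y ∈ (σ.simplify f).frontier, sec y ∈ σ.frontier ∧ f (sec y) = y)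
      (hrec : ∀ y ∈ (σ.simplify f).frontier, EqSim (h (sec y)) (h' y)) :
      EqSim (.null σ h z) (.null (σ.simplify f) h' z)

/-- `t̄ ≃ ū`: same length and the same equalities among components. -/
def tupleEquiv {A B : Type} (t : List A) (u : List B) : Prop :=
  t.length = u.length ∧ ∀ i j, i < t.length → j < t.length → (t[i]? = t[j]? ↔ u[i]? = u[j]?)

/-- Equivalence of atoms up to simplification. -/
noncomputable def AtomEqSim (α β : Atom TermT) : Prop :=
  β.pred = Nat.pair α.pred (Encodable.encode (idTuple α.args)) ∧
  tupleEquiv (uniqueList α.args) β.args ∧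
  List.Forall₂ EqSim (uniqueList α.args) β.args

/-! ### Linearization -/

/-- The symbolic representation of a type: a canonical guard atom over positive integers
together with a finite set of further atoms over its terms. -/
abbrev SigmaType := Atom ℕ × Finset (Atom ℕ)

/-- A canonical tuple of positive integers: `t₁ = 1` and `tᵢ ≤ max(t₁,…,tᵢ₋₁) + 1`. -/
def IsCanonicalTuple (l : List ℕ) : Prop :=
  ∀ (i : ℕ) (h : i < l.length), 1 ≤ l[i] ∧ l[i] ≤ ((l.take i).foldr max 0) + 1

def atomsOfType (τ : SigmaType) : Finset (Atom ℕ) := insert τ.1 τ.2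

def IsSigmaType (S : Set TGD) (τ : SigmaType) : Prop :=
  IsCanonicalTuple τ.1.args ∧ τ.1.sig ∈ sch S ∧
  (∀ b ∈ τ.2, b.sig ∈ sch S ∧ ∀ t ∈ b.args, t ∈ τ.1.args) ∧ τ.1 ∉ τ.2

open Classical in
noncomputable def setToFinset {α : Type} (s : Set α) : Finset α :=
  if h : s.Finite then h.toFinset else ∅

open Classical in
/-- Canonical renaming: the `i`-th distinct value of `base` (by first occurrence)
is sent to the integer `i` (1-based). -/
noncomputable def canonInt {α : Type} (base : List α) (c : α) : ℕ :=
  (uniqueList base).idxOf c + 1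

/-- The type (over the constants of `a`) of the database atom `a` w.r.t. `D` and `S`. -/
def typeOfDBAtom (D : Database) (S : Set TGD) (a : Atom ℕ) : Set (Atom ℕ) :=
  {b | (b.map TermT.const) ∈ chase D S ∧ ∀ c ∈ b.args, c ∈ a.args}

/-- The linearization of a database atom: `[τ](t̄)` where `τ` encodes the atom and its type. -/
noncomputable def linAtom (D : Database) (S : Set TGD) (a : Atom ℕ) : Atom ℕ :=
  let ρ : ℕ → ℕ := canonInt a.args
  let g : Atom ℕ := a.map ρ
  let τ : SigmaType := (g, (setToFinset ((Atom.map ρ) '' typeOfDBAtom D S a)).erase g)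
  ⟨Encodable.encode τ, a.args⟩

/-- `lin(D)`. -/
noncomputable def linDB (D : Database) (S : Set TGD) : Database := D.image (linAtom D S)

/-- `complete(I,Σ)`: the atoms of the chase of `I` whose terms all belong to `adom(I)`. -/
def completeDB (I : Database) (S : Set TGD) : Set (Atom ℕ) :=
  {a | (a.map TermT.const) ∈ chase I S ∧ ∀ c ∈ a.args, ∃ b ∈ I, c ∈ b.args}

/-- The index (1-based) of an existential variable of a TGD. -/
noncomputable def TGD.exIndex (σ : TGD) (v : ℕ) : ℕ := (σ.exVars.sort (· ≤ ·)).idxOf v + 1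

/-- The function `f` of the linearization: frontier variables are mapped by `h`, the `i`-th
existential variable to `ar(Σ) + i`. -/
noncomputable def headMap (S : Set TGD) (σ : TGD) (h : ℕ → ℕ) : ℕ → ℕ :=
  fun v => if v ∈ σ.frontier then h v else arity S + σ.exIndex v

/-- The Σ-type associated with the head atom `b` of `σ` in the linearization step. -/
noncomputable def headTypeOf (S : Set TGD) (σ : TGD) (τ : SigmaType) (h : ℕ → ℕ)
    (b : Atom ℕ) : SigmaType :=
  let f := headMap S σ h
  let αi : Atom ℕ := b.map f
  let I : Database := (σ.head.map (Atom.map f)).toFinset ∪ atomsOfType τ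
  let Ti : Set (Atom ℕ) := {β | β ∈ completeDB I S ∧ ∀ t ∈ β.args, t ∈ αi.args} \ {αi}
  let ρ : ℕ → ℕ := canonInt αi.args
  (αi.map ρ, setToFinset ((Atom.map ρ) '' Ti))

/-- The linearization of the guarded TGD `σ` induced by the Σ-type `τ` and the
homomorphism `h` from `body(σ)` to `atoms(τ)` mapping the guard to `guard(τ)`. -/
noncomputable def linTGD (S : Set TGD) (σ : TGD) (τ : SigmaType) (h : ℕ → ℕ) : TGD where
  body := [⟨Encodable.encode τ, σ.guard.args⟩]
  head := σ.head.map (fun b => ⟨Encodable.encode (headTypeOf S σ τ h b), b.args⟩)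
  body_ne := by simp
  head_ne := by
    intro hcon
    exact σ.head_ne (List.map_eq_nil_iff.mp hcon)

def IsTypeHom (S : Set TGD) (σ : TGD) (τ : SigmaType) (h : ℕ → ℕ) : Prop :=
  (∀ b ∈ σ.body, b.map h ∈ atomsOfType τ) ∧ σ.guard.map h = τ.1

/-- `lin(Σ)`. -/
def linTGDs (S : Set TGD) : Set TGD :=
  {ρ | ∃ σ ∈ S, ∃ τ : SigmaType, IsSigmaType S τ ∧
    ∃ h : ℕ → ℕ, IsTypeHom S σ τ h ∧ ρ = linTGD S σ τ h}

/-- Equivalence of terms up to linearization. -/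
inductive EqLin (S : Set TGD) : TermT → TermT → Prop
  | const (c : ℕ) : EqLin S (.const c) (.const c)
  | null (σ : TGD) (τ : SigmaType) (g : ℕ → ℕ) (h h' : ℕ → TermT) (z : ℕ)
      (hτ : IsSigmaType S τ) (hg : IsTypeHom S σ τ g)
      (hfr : ∀ y ∈ (linTGD S σ τ g).frontier, EqLin S (h y) (h' y)) :
      EqLin S (.null σ h z) (.null (linTGD S σ τ g) h' z)

/-- The type of an atom of the chase: all chase atoms whose terms occur in it. -/
def typeOf (D : Database) (S : Set TGD) (α : Atom TermT) : Set (Atom TermT) :=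
  {β ∈ chase D S | ∀ t ∈ β.args, t ∈ α.args}

/-- Equivalence of atoms up to linearization. -/
def AtomEqLin (D : Database) (S : Set TGD) (α β : Atom TermT) : Prop :=
  ∃ τ : SigmaType, β.pred = Encodable.encode τ ∧ IsSigmaType S τ ∧
    (∃ μ : TermT → ℕ,
      Set.BijOn μ (adom (typeOf D S α)) {k | ∃ a ∈ atomsOfType τ, k ∈ a.args} ∧
      (Atom.map μ) '' typeOf D S α = ↑(atomsOfType τ) ∧
      α.map μ = τ.1) ∧
    tupleEquiv α.args β.args ∧ List.Forall₂ (EqLin S) α.args β.args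

noncomputable def gsimpleDB (D : Database) (S : Set TGD) : Database := simpleDB (linDB D S)
def gsimpleTGDs (S : Set TGD) : Set TGD := simpleTGDs (linTGDs S)



def DGEdge (S : Set TGD) (p q : Pos) : Prop := NormalEdge S p q ∨ SpecialEdge S p q

def SpLt (S : Set TGD) (p q : Pos) : Prop :=
  ∃ r s, Relation.ReflTransGen (DGEdge S) p r ∧ SpecialEdge S r s ∧
    Relation.ReflTransGen (DGEdge S) s q

def LEdge (S : Set TGD) (b : Bool) (p q : Pos) : Prop :=
  if b then SpecialEdge S p q else NormalEdge S p q

def LWalk (S : Set TGD) (p q : Pos) (b : Prop) : Prop :=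
  ∃ (n : ℕ) (c : ℕ → Pos) (sp : ℕ → Bool), c 0 = p ∧ c n = q ∧
    (∀ i < n, LEdge S (sp i) (c i) (c (i + 1))) ∧ (b → ∃ i < n, sp i = true)

lemma LWalk.cons {S : Set TGD} {p q r : Pos} {b : Prop} (l : Bool) (h : LEdge S l p q)
    (w : LWalk S q r b) : LWalk S p r (b ∨ l = true) := by
  obtain ⟨n, c, sp, h0, hn, he, hb⟩ := w
  refine ⟨n + 1, fun i => Nat.casesOn i p c, fun i => Nat.casesOn i l sp, rfl, hn, ?_, ?_⟩
  · intro i hi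
    cases i with
    | zero => simpa [h0] using h
    | succ i => exact he i (by omega)
  · rintro (hb' | hl)
    · obtain ⟨i, hi, hs⟩ := hb hb'
      exact ⟨i + 1, by omega, hs⟩
    · exact ⟨0, by omega, hl⟩

lemma LWalk.mono {S : Set TGD} {p q : Pos} {b b' : Prop} (hb : b' → b)
    (w : LWalk S p q b) : LWalk S p q b' := by
  obtain ⟨n, c, sp, h0, hn, he, h⟩ := w
  exact ⟨n, c, sp, h0, hn, he, fun x => h (hb x)⟩

lemma LWalk.append {S : Set TGD} {p q r : Pos} {b : Prop}
    (h : Relation.ReflTransGen (DGEdge S) p q) (w : LWalk S q r b) : LWalk S p r b := by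
  induction h using Relation.ReflTransGen.head_induction_on with
  | refl => exact w
  | head h _ ih =>
    rcases h with h | h
    · exact (LWalk.cons false (by simpa [LEdge] using h) ih).mono Or.inl
    · exact (LWalk.cons true (by simpa [LEdge] using h) ih).mono Or.inl

lemma SpLt.walk {S : Set TGD} {p q : Pos} (h : SpLt S p q) : LWalk S p q True := by
  obtain ⟨r, s, h1, h2, h3⟩ := h
  have w0 : LWalk S q q False := ⟨0, fun _ => q, fun _ => false, rfl, rfl, by simp, by simp⟩
  exact (((w0.append h3).cons true (by simpa [LEdge] using h2)).mono (b' := True)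
    (fun _ => Or.inr rfl)).append h1

lemma SpLt.irrefl {D : Database} {S : Set TGD} (hwa : DWeaklyAcyclic D S) {p : Pos}
    (hp : ∃ a ∈ D, Reach S a.sig p.1) : ¬ SpLt S p p := by
  intro h
  obtain ⟨n, c, sp, h0, hn, he, hb⟩ := h.walk
  obtain ⟨i, hi, hs⟩ := hb trivial
  obtain ⟨m, rfl⟩ : ∃ m, n = m + 1 := ⟨n - 1, by omega⟩
  exact hwa ⟨m, c, sp, by rw [hn, h0], fun i hi => he i (by omega), ⟨i, by omega, hs⟩,
    0, by omega, by rw [h0]; exact hp⟩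

def posSet (S : Set TGD) : Set Pos := sch S ×ˢ Set.Iio (arity S)

noncomputable def prank (S : Set TGD) (q : Pos) : ℕ := {p ∈ posSet S | SpLt S p q}.ncard

lemma sch_finite {S : Set TGD} (hfin : S.Finite) : (sch S).Finite := by
  have : sch S = ⋃ σ ∈ S, (fun a : Atom ℕ => a.sig) '' {a | a ∈ σ.atomsList} := by
    ext p; simp [sch]
  rw [this]
  exact hfin.biUnion fun σ _ => (List.finite_toSet _).image _

lemma posSet_finite {S : Set TGD} (hfin : S.Finite) : (posSet S).Finite :=
  (sch_finite hfin).prod (Set.finite_Iio _)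

lemma posSet_ncard (S : Set TGD) : (posSet S).ncard = dSL S := by
  rw [posSet, Set.ncard_prod, dSL]
  congr 1
  rw [← Finset.coe_Iio, Set.ncard_coe_finset, Nat.card_Iio]

lemma mem_posSet {S : Set TGD} (hfin : S.Finite) {σ : TGD} (hσ : σ ∈ S) {a : Atom ℕ}
    (ha : a ∈ σ.atomsList) {x : ℕ} {p : Pos} (h : occursAt x a p) : p ∈ posSet S := by
  obtain ⟨h1, h2⟩ := h
  have hs : a.sig ∈ sch S := ⟨σ, hσ, a, ha, rfl⟩
  refine ⟨h1 ▸ hs, ?_⟩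
  have : p.2 < a.args.length := by
    by_contra hc
    rw [List.getElem?_eq_none (by omega)] at h2
    cases h2
  exact lt_of_lt_of_le this
    (le_csSup ((sch_finite hfin).image _).bddAbove ⟨a.sig, hs, rfl⟩)

lemma prank_normal {S : Set TGD} (hfin : S.Finite) {p q : Pos} (h : NormalEdge S p q) :
    prank S p ≤ prank S q := by
  refine Set.ncard_le_ncard ?_ ((posSet_finite hfin).subset (Set.sep_subset _ _))
  rintro x ⟨hx, r, s, h1, h2, h3⟩
  exact ⟨hx, r, s, h1, h2, h3.tail (Or.inl h)⟩

lemma prank_special {D : Database} {S : Set TGD} (hwa : DWeaklyAcyclic D S) (hfin : S.Finite)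
    {p q : Pos} (hp : p ∈ posSet S) (hD : ∃ a ∈ D, Reach S a.sig p.1)
    (h : SpecialEdge S p q) : prank S p < prank S q := by
  refine Set.ncard_lt_ncard ?_ ((posSet_finite hfin).subset (Set.sep_subset _ _))
  refine Set.ssubset_iff_of_subset ?_ |>.2 ⟨p, ⟨hp, p, q, .refl, h, .refl⟩, ?_⟩
  · rintro x ⟨hx, r, s, h1, h2, h3⟩
    exact ⟨hx, r, s, h1, h2, h3.tail (Or.inr h)⟩
  · exact fun hx => SpLt.irrefl hwa hD hx.2

lemma prank_lt {D : Database} {S : Set TGD} (hwa : DWeaklyAcyclic D S) (hfin : S.Finite)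
    {q : Pos} (hq : q ∈ posSet S) (hD : ∃ a ∈ D, Reach S a.sig q.1) :
    prank S q < dSL S := by
  rw [← posSet_ncard]
  refine Set.ncard_lt_ncard ?_ (posSet_finite hfin)
  exact Set.ssubset_iff_of_subset (Set.sep_subset _ _) |>.2
    ⟨q, hq, fun hx => SpLt.irrefl hwa hD hx.2⟩

lemma map_sig {T U : Type} (f : T → U) (a : Atom T) : (a.map f).sig = a.sig := by
  simp [Atom.map, Atom.sig]

lemma InChase.reach {D : Database} {S : Set TGD} {a : Atom TermT} (h : InChase D S a) :
    ∃ d ∈ D, Reach S d.sig a.sig := by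
  induction h with
  | @db a ha => exact ⟨a, ha, by rw [map_sig]; exact .refl⟩
  | @step σ hσ h hb a ha ih =>
    obtain ⟨b, hbm, rfl⟩ := ha
    obtain ⟨c, hc⟩ := List.exists_mem_of_ne_nil _ σ.body_ne
    obtain ⟨d, hd, hr⟩ := ih c hc
    refine ⟨d, hd, hr.tail ?_⟩
    exact ⟨σ, hσ, ⟨c, hc, (map_sig _ _).symm⟩, ⟨b, hbm, (map_sig _ _).symm⟩⟩

lemma mem_foldr_vars (l : List (Atom ℕ)) (x : ℕ) :
    x ∈ l.foldr (fun a s => atomVars a ∪ s) ∅ ↔ ∃ a ∈ l, x ∈ a.args := by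
  induction l with
  | nil => simp
  | cons a l ih =>
    rw [List.foldr_cons, Finset.mem_union, ih]
    simp [atomVars]

lemma exists_occ {x : ℕ} {a : Atom ℕ} (h : x ∈ a.args) : ∃ i, occursAt x a (a.sig, i) := by
  obtain ⟨i, hi⟩ := List.mem_iff_getElem?.1 h
  exact ⟨i, rfl, hi⟩

lemma occ_map {T U : Type} {f : T → U} {a : Atom T} {x : T} {p : Pos} (h : occursAt x a p) :
    occursAt (f x) (a.map f) p := by
  refine ⟨by rw [map_sig]; exact h.1, ?_⟩
  simp [Atom.map, h.2]

lemma occ_map_inv {T U : Type} {f : T → U} {a : Atom T} {t : U} {p : Pos}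
    (h : occursAt t (a.map f) p) : ∃ x, occursAt x a p ∧ f x = t := by
  obtain ⟨h1, h2⟩ := h
  rw [map_sig] at h1
  simp only [Atom.map, List.getElem?_map, Option.map_eq_some_iff] at h2
  obtain ⟨x, hx, rfl⟩ := h2
  exact ⟨x, ⟨h1, hx⟩, rfl⟩

lemma occ_mem {T : Type} {a : Atom T} {x : T} {p : Pos} (h : occursAt x a p) : x ∈ a.args :=
  List.mem_iff_getElem?.2 ⟨_, h.2⟩

lemma depth_le_rank {D : Database} {S : Set TGD} (hwa : DWeaklyAcyclic D S) (hfin : S.Finite)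
    {a : Atom TermT} (h : InChase D S a) :
    ∀ (t : TermT) (q : Pos), occursAt t a q → t.depth ≤ prank S q + 1 := by
  induction h with
  | db ha =>
    intro t q ht
    obtain ⟨x, -, rfl⟩ := occ_map_inv ht
    simp [TermT.depth]
  | @step σ hσ h hb a ha ih =>
    intro t q ht
    obtain ⟨b, hbm, rfl⟩ := ha
    obtain ⟨x, hx, rfl⟩ := occ_map_inv ht
    have key : ∀ y ∈ σ.frontier, ∃ p, (∃ c ∈ σ.body, occursAt y c p) ∧ p ∈ posSet S ∧
        (∃ a ∈ D, Reach S a.sig p.1) ∧ (h y).depth ≤ prank S p + 1 := by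
      intro y hy
      have hy1 := (Finset.mem_inter.1 hy).1
      obtain ⟨c, hc, hyc⟩ := (mem_foldr_vars _ _).1 hy1
      obtain ⟨i, hi⟩ := exists_occ hyc
      refine ⟨_, ⟨c, hc, hi⟩, mem_posSet hfin hσ (List.mem_append_left _ hc) hi, ?_,
        ih c hc _ _ (occ_map hi)⟩
      have := (hb c hc).reach
      rwa [map_sig] at this
    by_cases hf : x ∈ σ.frontier
    · obtain ⟨p, hp, -, -, hd⟩ := key x hf
      have := prank_normal hfin (p := p) (q := q) ⟨σ, hσ, x, hf, hp, b, hbm, hx⟩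
      simp only [TGD.mu, if_pos hf]
      omega
    · simp only [TGD.mu, if_neg hf, TermT.depth]
      have hxh : x ∈ σ.headVars := (mem_foldr_vars _ _).2 ⟨b, hbm, occ_mem hx⟩
      have hex : x ∈ σ.exVars := Finset.mem_sdiff.2
        ⟨hxh, fun hc => hf (Finset.mem_inter.2 ⟨hc, hxh⟩)⟩
      have : σ.frontier.sup (fun y => (σ.restrict h y).depth) ≤ prank S q := by
        refine Finset.sup_le fun y hy => ?_
        obtain ⟨p, hp, hpS, hD, hd⟩ := key y hy
        have := prank_special hwa hfin hpS hD (q := q) ⟨σ, hσ, y, hy, hp, x, hex, b, hbm, hx⟩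
        simp only [TGD.restrict, if_pos hy]
        omega
      omega

lemma depth_le_dSL {D : Database} {S : Set TGD} (hwa : DWeaklyAcyclic D S) (hfin : S.Finite)
    {a : Atom TermT} (h : InChase D S a) {t : TermT} (ht : t ∈ a.args) : t.depth ≤ dSL S := by
  obtain ⟨i, hi⟩ := List.mem_iff_getElem?.1 ht
  have hocc : occursAt t a (a.sig, i) := ⟨rfl, hi⟩
  have h1 := depth_le_rank hwa hfin h t _ hocc
  have hr := h.reach
  cases h with
  | db ha =>
    obtain ⟨x, -, rfl⟩ := occ_map_inv hocc
    simp [TermT.depth]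
  | @step σ hσ h hb _ ha =>
    obtain ⟨b, hbm, rfl⟩ := ha
    obtain ⟨x, hx, rfl⟩ := occ_map_inv hocc
    have := prank_lt hwa hfin (mem_posSet hfin hσ (List.mem_append_right _ hbm) hx) hr
    omega

/-- Terms of bounded depth that can occur in the chase. -/
def termSet (D : Database) (S : Set TGD) : ℕ → Set TermT
  | 0 => insert (.const 0) {t | ∃ a ∈ D, ∃ c ∈ a.args, t = .const c}
  | k + 1 => termSet D S k ∪ {t | ∃ σ ∈ S, ∃ z ∈ σ.headVars, ∃ g : ℕ → TermT,
      (∀ x ∈ σ.frontier, g x ∈ termSet D S k) ∧ (∀ x ∉ σ.frontier, g x = .const 0) ∧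
      t = .null σ g z}

lemma funs_finite (F : Finset ℕ) (T : Set TermT) (hT : T.Finite) :
    {g : ℕ → TermT | (∀ x ∈ F, g x ∈ T) ∧ (∀ x ∉ F, g x = .const 0)}.Finite := by
  have hp : (Set.univ.pi (fun _ : F => T)).Finite := Set.Finite.pi' (fun _ => hT) |>.subset
    (fun f hf i => hf i trivial)
  refine (hp.image (fun (f : F → TermT) (x : ℕ) =>
    if hx : x ∈ F then f ⟨x, hx⟩ else .const 0)).subset ?_
  rintro g ⟨h1, h2⟩
  refine ⟨fun x => g x, fun x _ => h1 x x.2, ?_⟩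
  funext x
  by_cases hx : x ∈ F
  · simp [hx]
  · simp [hx, h2 x hx]

lemma termSet_finite (D : Database) {S : Set TGD} (hfin : S.Finite) (k : ℕ) :
    (termSet D S k).Finite := by
  induction k with
  | zero =>
    refine Set.Finite.insert _ ?_
    have : {t | ∃ a ∈ D, ∃ c ∈ a.args, t = TermT.const c} =
        ⋃ a ∈ (D : Set (Atom ℕ)), TermT.const '' {c | c ∈ a.args} := by
      ext t; simp [eq_comm]
    rw [this]
    exact D.finite_toSet.biUnion fun a _ => (List.finite_toSet _).image _
  | succ k ih =>
    refine ih.union ?_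
    refine (hfin.biUnion (t := fun σ => ⋃ z ∈ (σ.headVars : Set ℕ),
      (fun g => TermT.null σ g z) '' {g : ℕ → TermT | (∀ x ∈ σ.frontier, g x ∈ termSet D S k) ∧
        (∀ x ∉ σ.frontier, g x = .const 0)}) fun σ _ =>
      σ.headVars.finite_toSet.biUnion fun z _ => (funs_finite _ _ ih).image _).subset ?_
    rintro t ⟨σ, hσ, z, hz, g, h1, h2, rfl⟩
    simp only [Set.mem_iUnion]
    exact ⟨σ, hσ, z, hz, g, ⟨h1, h2⟩, rfl⟩

lemma termSet_mono (D : Database) (S : Set TGD) : Monotone (termSet D S) :=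
  monotone_nat_of_le_succ fun _ => Set.subset_union_left

lemma mem_termSet {D : Database} {S : Set TGD} {a : Atom TermT} (h : InChase D S a) :
    ∀ t ∈ a.args, t ∈ termSet D S t.depth := by
  induction h with
  | @db a ha =>
    intro t ht
    simp only [Atom.map, List.mem_map] at ht
    obtain ⟨c, hc, rfl⟩ := ht
    exact Or.inr ⟨a, ha, c, hc, rfl⟩
  | @step σ hσ h hb a ha ih =>
    intro t ht
    obtain ⟨b, hbm, rfl⟩ := ha
    simp only [Atom.map, List.mem_map] at ht
    obtain ⟨x, hx, rfl⟩ := ht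
    have key : ∀ y ∈ σ.frontier, h y ∈ termSet D S (h y).depth := by
      intro y hy
      obtain ⟨c, hc, hyc⟩ := (mem_foldr_vars _ _).1 (Finset.mem_inter.1 hy).1
      exact ih c hc _ (List.mem_map_of_mem hyc)
    by_cases hf : x ∈ σ.frontier
    · simp only [TGD.mu, if_pos hf]
      exact key x hf
    · simp only [TGD.mu, if_neg hf, TermT.depth]
      rw [Nat.add_comm]
      refine Or.inr ⟨σ, hσ, x, (mem_foldr_vars _ _).2 ⟨b, hbm, hx⟩, _, ?_, ?_, rfl⟩
      · intro y hy
        have h1 : (σ.restrict h y).depth ≤ σ.frontier.sup (fun y => (σ.restrict h y).depth) :=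
          Finset.le_sup (f := fun y => (σ.restrict h y).depth) hy
        refine termSet_mono D S h1 ?_
        simp only [TGD.restrict, if_pos hy]
        exact key y hy
      · intro y hy
        simp only [TGD.restrict, if_neg hy]

lemma InChase.sig_mem {D : Database} {S : Set TGD} {a : Atom TermT} (h : InChase D S a) :
    a.sig ∈ sch S ∪ (fun a : Atom ℕ => a.sig) '' (D : Set (Atom ℕ)) := by
  cases h with
  | @db a ha => exact Or.inr ⟨a, ha, (map_sig _ _).symm⟩
  | @step σ hσ h hb _ ha =>
    obtain ⟨b, hbm, rfl⟩ := ha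
    exact Or.inl ⟨σ, hσ, b, List.mem_append_right _ hbm, (map_sig _ _).symm⟩

lemma chase_finite {D : Database} {S : Set TGD} (hwa : DWeaklyAcyclic D S) (hfin : S.Finite) :
    (chase D S).Finite := by
  have hT := termSet_finite D hfin (dSL S)
  have hs : (sch S ∪ (fun a : Atom ℕ => a.sig) '' (D : Set (Atom ℕ))).Finite :=
    (sch_finite hfin).union (D.finite_toSet.image _)
  have hl : ∀ n, {l : List TermT | l.length = n ∧ ∀ t ∈ l, t ∈ termSet D S (dSL S)}.Finite :=
    fun n => by
      have : Finite (termSet D S (dSL S)) := hT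
      refine ((List.finite_length_eq (termSet D S (dSL S)) n).image
        (List.map Subtype.val)).subset ?_
      rintro l ⟨h1, h2⟩
      exact ⟨l.attach.map (fun t => ⟨t.1, h2 t.1 t.2⟩), by simpa using h1, by simp⟩
  refine (hs.biUnion (t := fun p => (fun l => Atom.mk p.1 l) ''
    {l : List TermT | l.length = p.2 ∧ ∀ t ∈ l, t ∈ termSet D S (dSL S)})
    fun p _ => (hl p.2).image _).subset ?_
  intro a ha
  simp only [Set.mem_iUnion]
  exact ⟨a.sig, InChase.sig_mem ha, a.args, ⟨rfl, fun t ht =>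
    termSet_mono D S (depth_le_dSL hwa hfin ha ht) (mem_termSet ha t ht)⟩, rfl⟩

/-- If the finite set `Σ` of TGDs is `D`-weakly-acyclic, then
`maxdepth(D,Σ) ≤ d_SL(Σ) = |sch(Σ)|·ar(Σ)`. -/
theorem maxdepth_le_of_weakly_acyclic (D : Database) (S : Set TGD) (hfin : S.Finite)
    (hwa : DWeaklyAcyclic D S) :
    maxdepth D S ≤ ((dSL S : ℕ) : ℕ∞) := by
  rw [maxdepth, if_pos (chase_finite hwa hfin)]
  refine iSup₂_le fun t ht => ?_
  obtain ⟨a, ha, hta⟩ := ht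
  exact_mod_cast depth_le_dSL hwa hfin ha hta
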